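/- Let 1 < p < ∞ and n ∈ ℕ. Suppose the n-tuple (x_1,…,x_n) of points of ℓ_p has Property K, and let X be a Banach space that uniformly contains the spaces ℓ_p^m, m ∈ ℕ. Then the metric space {x_1,…,x_n} with the metric inherited from ℓ_p embeds isometrically into X. -/

import Mathlib

open MeasureTheory
open scoped ENNReal
noncomputable section

/-- The index set of pairs `(i,j)` with `i < j`, indexing the coordinates of
`ℝ^{n(n-1)/2}`. -/
abbrev PairIdx (n : ℕ) := {q : Fin n × Fin n // q.1 < q.2}

/-- `‖v‖_p` for `v ∈ ℝ^n`. -/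
def pNorm (p : ℝ) {n : ℕ} (v : Fin n → ℝ) : ℝ := (∑ k, |v k| ^ p) ^ (1 / p)

/-- The map `F_n : (ℝ^n)^n → ℝ^{n(n-1)/2}`, `F_n(x₁,…,xₙ) = (‖x_i - x_j‖_p^p)_{i<j}`. -/
def Fmap (p : ℝ) (n : ℕ) (x : Fin n → Fin n → ℝ) : PairIdx n → ℝ :=
  fun q => ∑ k, |x q.val.1 k - x q.val.2 k| ^ p

/-- `G_n`: the set of points of `(ℝ^n)^n` where the derivative of `F_n` has full rank
`n(n-1)/2`. -/
def Gset (p : ℝ) (n : ℕ) : Set (Fin n → Fin n → ℝ) :=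
  {x | LinearMap.rank (fderiv ℝ (Fmap p n) x).toLinearMap = ((n * (n - 1) / 2 : ℕ) : Cardinal)}

/-- Property K for an `n`-tuple of points of `ℓ_p` (given by their coordinates). -/
def PropertyKSeq (p : ℝ) (n : ℕ) (x : Fin n → ℕ → ℝ) : Prop :=
  ∃ m : Fin n → ℕ, StrictMono m ∧ (fun i j => x i (m j)) ∈ Gset p n

/-- Property K for an `n`-tuple of points of `ℓ_p^N`. -/
def PropertyKFin (p : ℝ) (n N : ℕ) (x : Fin n → Fin N → ℝ) : Prop :=
  ∃ m : Fin n → Fin N, StrictMono m ∧ (fun i j => x i (m j)) ∈ Gset p n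

/-- A Borel set `A` in a (separable) Banach space is Haar null if there is a Borel
probability measure `μ` with `μ(x + A) = 0` for all `x`. -/
def HaarNull {X : Type*} [AddGroup X] [MeasurableSpace X] (A : Set X) : Prop :=
  ∃ μ : Measure X, IsProbabilityMeasure μ ∧ ∀ x : X, μ ((fun a => x + a) '' A) = 0

/-- `X` uniformly contains the spaces `ℓ_p^m`, `m ∈ ℕ`. -/
def UnifContainsLp (p : ℝ≥0∞) [Fact (1 ≤ p)] (X : Type*) [NormedAddCommGroup X]
    [NormedSpace ℝ X] : Prop :=
  ∃ C : ℝ, 1 ≤ C ∧ ∀ m : ℕ, ∃ (Y : Submodule ℝ X)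
    (T : PiLp p (fun _ : Fin m => ℝ) ≃L[ℝ] Y),
      ‖(T : PiLp p (fun _ : Fin m => ℝ) →L[ℝ] Y)‖ *
        ‖(T.symm : Y →L[ℝ] PiLp p (fun _ : Fin m => ℝ))‖ ≤ C

-- test lp coercion and instances

section

open Filter Topology

/-! ### Limits along a fixed ultrafilter -/

/-- The limit of a real sequence along the fixed ultrafilter `hyperfilter ℕ`. -/
def ulim (f : ℕ → ℝ) : ℝ := limUnder (hyperfilter ℕ : Filter ℕ) f

lemma tendsto_ulim {f : ℕ → ℝ} {a b : ℝ} (h : ∀ᶠ n in hyperfilter ℕ, f n ∈ Set.Icc a b) :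
    Tendsto f (hyperfilter ℕ) (𝓝 (ulim f)) := by
  obtain ⟨x, -, hx⟩ := (isCompact_Icc (a := a) (b := b)).ultrafilter_le_nhds
    ((hyperfilter ℕ).map f) (by rwa [le_principal_iff])
  exact tendsto_nhds_limUnder ⟨x, hx⟩

lemma ulim_eq {f : ℕ → ℝ} {x : ℝ} (h : Tendsto f (hyperfilter ℕ) (𝓝 x)) : ulim f = x :=
  h.limUnder_eq

lemma ulim_mem {f : ℕ → ℝ} {a b : ℝ} (h : ∀ᶠ n in hyperfilter ℕ, f n ∈ Set.Icc a b) :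
    ulim f ∈ Set.Icc a b :=
  isClosed_Icc.mem_of_tendsto (tendsto_ulim h) h

lemma eventually_hyperfilter_ge (N : ℕ) : ∀ᶠ n in (hyperfilter ℕ : Filter ℕ), N ≤ n :=
  Nat.hyperfilter_le_atTop (eventually_ge_atTop N)

/-! ### Spreading functionals -/

/-- The `p`-th power of the `ℓ_p` norm of a finite list. -/
def pSum (p : ℝ) (l : List ℝ) : ℝ := (l.map fun a => |a| ^ p).sum

/-- The list of nonzero entries. -/
def nz (l : List ℝ) : List ℝ := l.filter fun a => decide (a ≠ 0)

/-- The linear combination of `y 0, y 1, …` with coefficients from a list. -/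
def comb {X : Type*} [AddCommGroup X] [Module ℝ X] : (ℕ → X) → List ℝ → X
  | _, [] => 0
  | y, a :: l => a • y 0 + comb (fun i => y (i + 1)) l

/-- A functional on finite lists, thought of as the norm `a ↦ ‖∑ a_i e_i‖` with respect to a
spreading sequence which is `C`-equivalent to the unit vectors of `ℓ_p` and finitely
representable in `X`. -/
structure IsSpreading (p C : ℝ) (X : Type*) [NormedAddCommGroup X] [NormedSpace ℝ X]
    (S : List ℝ → ℝ) : Prop where
  congr_nz : ∀ {l l' : List ℝ}, nz l = nz l' → S l = S l'
  lipschitz : ∀ {l l' : List ℝ}, l.length = l'.length →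
    |S l - S l'| ≤ C * pSum p (List.zipWith (· - ·) l l') ^ (1 / p)
  lower : ∀ l : List ℝ, pSum p l ^ (1 / p) ≤ S l
  homog : ∀ (c : ℝ) (l : List ℝ), S (l.map (c * ·)) = |c| * S l
  rep : ∀ (F : Finset (List ℝ)) {ε : ℝ}, 0 < ε →
    ∃ y : ℕ → X, ∀ l ∈ F, |‖comb y l‖ - S l| < ε

lemma pSum_nonneg (p : ℝ) (l : List ℝ) : 0 ≤ pSum p l := by
  refine List.sum_nonneg ?_
  simp only [List.mem_map]
  rintro _ ⟨a, -, rfl⟩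
  positivity

@[simp] lemma pSum_nil (p : ℝ) : pSum p [] = 0 := rfl

@[simp] lemma pSum_cons (p a : ℝ) (l : List ℝ) : pSum p (a :: l) = |a| ^ p + pSum p l := by
  simp [pSum]

@[simp] lemma pSum_append (p : ℝ) (l l' : List ℝ) : pSum p (l ++ l') = pSum p l + pSum p l' := by
  simp [pSum]

lemma pSum_map_mul (p c : ℝ) (l : List ℝ) : pSum p (l.map (c * ·)) = |c| ^ p * pSum p l := by
  induction l with
  | nil => simp
  | cons a l ih => simp [ih, abs_mul, Real.mul_rpow (abs_nonneg _) (abs_nonneg _), mul_add]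

@[simp] lemma nz_nil : nz [] = [] := rfl

@[simp] lemma nz_append (l l' : List ℝ) : nz (l ++ l') = nz l ++ nz l' := List.filter_append ..

lemma nz_cons_zero (l : List ℝ) : nz (0 :: l) = nz l := by simp [nz]

lemma nz_cons_of_ne {a : ℝ} (ha : a ≠ 0) (l : List ℝ) : nz (a :: l) = a :: nz l := by
  simp [nz, ha]

section comb

variable {X : Type*} [AddCommGroup X] [Module ℝ X]

lemma comb_append (y : ℕ → X) (l l' : List ℝ) :
    comb y (l ++ l') = comb y l + comb (fun i => y (l.length + i)) l' := by
  induction l generalizing y with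
  | nil => simp [comb]
  | cons a l ih => simp [comb, ih, add_assoc, add_comm]

lemma comb_map_mul (y : ℕ → X) (c : ℝ) (l : List ℝ) :
    comb y (l.map (c * ·)) = c • comb y l := by
  induction l generalizing y with
  | nil => simp [comb]
  | cons a l ih => simp [comb, ih, mul_smul]

lemma comb_ofFn (y : ℕ → X) {k : ℕ} (a : Fin k → ℝ) :
    comb y (List.ofFn a) = ∑ i, a i • y i := by
  induction k generalizing y with
  | zero => simp [comb]
  | succ k ih => simp [comb, ih, Fin.sum_univ_succ]

end comb

/-! ### The spreading model of a sequence of copies of `ℓ_p^m` -/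

section SpreadingModel

variable {X : Type*} [NormedAddCommGroup X] [NormedSpace ℝ X]

/-- `‖v‖_p^p` for a finitely supported sequence. -/
def finsuppPSum (p : ℝ) (v : ℕ →₀ ℝ) : ℝ := v.sum fun _ a => |a| ^ p

lemma finsuppPSum_add_single {p : ℝ} (hp : 0 < p) (v : ℕ →₀ ℝ) (a : ℝ) :
    ∀ᶠ n in (hyperfilter ℕ : Filter ℕ),
      finsuppPSum p (v + Finsupp.single n a) = finsuppPSum p v + |a| ^ p := by
  have h : ∀ᶠ n in (hyperfilter ℕ : Filter ℕ), n ∉ v.support :=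
    hyperfilter_le_cofinite v.support.finite_toSet.eventually_cofinite_notMem
  filter_upwards [h] with n hn
  have h0 : |(0 : ℝ)| ^ p = 0 := by simp [Real.zero_rpow hp.ne']
  rw [finsuppPSum, Finsupp.sum_add_index_of_disjoint, Finsupp.sum_single_index h0]
  · rfl
  · exact Finset.disjoint_of_subset_right Finsupp.support_single_subset
      (Finset.disjoint_singleton_right.2 hn)

/-- The iterated limit `lim_{n₁} lim_{n₂} … lim_m ‖T_m (v + ∑ l_i e_{n_i})‖`. -/
def iterLim (T : ℕ → (ℕ →₀ ℝ) →ₗ[ℝ] X) : List ℝ → (ℕ →₀ ℝ) → ℝ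
  | [], v => ulim fun m => ‖T m v‖
  | a :: l, v => ulim fun n => iterLim T l (v + Finsupp.single n a)

variable {p C : ℝ} {T : ℕ → (ℕ →₀ ℝ) →ₗ[ℝ] X}

lemma iterLim_nz (l : List ℝ) (v : ℕ →₀ ℝ) : iterLim T (nz l) v = iterLim T l v := by
  induction l generalizing v with
  | nil => rfl
  | cons a l ih =>
    rcases eq_or_ne a 0 with rfl | ha
    · rw [nz_cons_zero, ih, iterLim]
      simp only [Finsupp.single_zero, add_zero]
      exact (ulim_eq tendsto_const_nhds).symm
    · simp only [nz_cons_of_ne ha, iterLim, ih]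

variable (hp : 0 < p)
  (hupper : ∀ m v, ‖T m v‖ ≤ C * finsuppPSum p v ^ (1 / p))
  (hlower : ∀ v, ∀ᶠ m in (hyperfilter ℕ : Filter ℕ), finsuppPSum p v ^ (1 / p) ≤ ‖T m v‖)

include hp hupper hlower

lemma iterLim_mem (l : List ℝ) (v : ℕ →₀ ℝ) :
    iterLim T l v ∈ Set.Icc ((finsuppPSum p v + pSum p l) ^ (1 / p))
      (C * (finsuppPSum p v + pSum p l) ^ (1 / p)) := by
  induction l generalizing v with
  | nil =>
    refine ulim_mem ?_
    filter_upwards [hlower v] with m hm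
    rw [pSum_nil, add_zero]
    exact ⟨hm, hupper m v⟩
  | cons a l ih =>
    refine ulim_mem ?_
    filter_upwards [finsuppPSum_add_single hp v a] with n hn
    have := ih (v + Finsupp.single n a)
    rwa [hn, add_assoc, ← pSum_cons] at this

omit hp hlower in
lemma tendsto_iterLim_nil (v : ℕ →₀ ℝ) :
    Tendsto (fun m => ‖T m v‖) (hyperfilter ℕ) (𝓝 (iterLim T [] v)) :=
  tendsto_ulim (a := 0) (b := C * finsuppPSum p v ^ (1 / p)) <|
    .of_forall fun m => ⟨norm_nonneg _, hupper m v⟩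

lemma tendsto_iterLim_cons (a : ℝ) (l : List ℝ) (v : ℕ →₀ ℝ) :
    Tendsto (fun n => iterLim T l (v + Finsupp.single n a)) (hyperfilter ℕ)
      (𝓝 (iterLim T (a :: l) v)) := by
  refine tendsto_ulim (a := (finsuppPSum p v + pSum p (a :: l)) ^ (1 / p))
    (b := C * (finsuppPSum p v + pSum p (a :: l)) ^ (1 / p)) ?_
  filter_upwards [finsuppPSum_add_single hp v a] with n hn
  have := iterLim_mem hp hupper hlower l (v + Finsupp.single n a)
  rwa [hn, add_assoc, ← pSum_cons] at this

lemma iterLim_lipschitz {l l' : List ℝ} (h : l.length = l'.length) (v v' : ℕ →₀ ℝ) :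
    |iterLim T l v - iterLim T l' v'| ≤
      C * (finsuppPSum p (v - v') + pSum p (List.zipWith (· - ·) l l')) ^ (1 / p) := by
  induction l generalizing l' v v' with
  | nil =>
    obtain rfl : l' = [] := by simpa using h.symm
    refine le_of_tendsto ((tendsto_iterLim_nil hupper v).sub
      (tendsto_iterLim_nil hupper v')).abs (.of_forall fun m => ?_)
    refine (abs_norm_sub_norm_le _ _).trans ?_
    rw [← map_sub]
    simpa using hupper m (v - v')
  | cons a l ih =>
    obtain _ | ⟨a', l'⟩ := l'
    · simp at h
    refine le_of_tendsto ((tendsto_iterLim_cons hp hupper hlower a l v).sub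
      (tendsto_iterLim_cons hp hupper hlower a' l' v')).abs ?_
    filter_upwards [finsuppPSum_add_single hp (v - v') (a - a')] with n hn
    refine (ih (by simpa using h) _ _).trans_eq ?_
    rw [add_sub_add_comm, ← Finsupp.single_sub, hn, List.zipWith_cons_cons, pSum_cons, add_assoc]

lemma iterLim_smul (c : ℝ) (l : List ℝ) (v : ℕ →₀ ℝ) :
    iterLim T (l.map (c * ·)) (c • v) = |c| * iterLim T l v := by
  induction l generalizing v with
  | nil =>
    refine ulim_eq (((tendsto_iterLim_nil hupper v).const_mul |c|).congr fun m => ?_)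
    simp [norm_smul]
  | cons a l ih =>
    refine ulim_eq (((tendsto_iterLim_cons hp hupper hlower a l v).const_mul |c|).congr
      fun n => ?_)
    simp [← ih]

lemma iterLim_rep (k : ℕ) (F : Finset (List ℝ × (ℕ →₀ ℝ))) (hF : ∀ q ∈ F, q.1.length ≤ k)
    {ε : ℝ} (hε : 0 < ε) : ∃ (m : ℕ) (e : ℕ → ℕ →₀ ℝ), ∀ q ∈ F,
      |‖T m (q.2 + comb e q.1)‖ - iterLim T q.1 q.2| < ε := by
  classical
  induction k generalizing F ε with
  | zero =>
    have : ∀ᶠ m in (hyperfilter ℕ : Filter ℕ), ∀ q ∈ F, |‖T m q.2‖ - iterLim T [] q.2| < ε :=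
      (Filter.eventually_all_finset F).2 fun q _ =>
        (tendsto_iterLim_nil hupper q.2).eventually (Metric.ball_mem_nhds _ hε)
    obtain ⟨m, hm⟩ := this.exists
    refine ⟨m, 0, fun q hq => ?_⟩
    have h0 : q.1 = [] := by simpa using hF q hq
    simpa [h0, comb] using hm q hq
  | succ k ih =>
    have : ∀ᶠ n in (hyperfilter ℕ : Filter ℕ), ∀ q ∈ F,
        |iterLim T q.1.tail (q.2 + Finsupp.single n (q.1.headD 0)) - iterLim T q.1 q.2| <
          ε / 2 := by
      refine (Filter.eventually_all_finset F).2 fun q _ => ?_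
      obtain ⟨_ | ⟨a, l⟩, v⟩ := q
      · simp [half_pos hε]
      · exact (tendsto_iterLim_cons hp hupper hlower a l v).eventually
          (Metric.ball_mem_nhds _ (half_pos hε))
    obtain ⟨n, hn⟩ := this.exists
    obtain ⟨m, e, he⟩ := ih
      (F.image fun q => (q.1.tail, q.2 + Finsupp.single n (q.1.headD 0))) (by
        simp only [Finset.mem_image]
        rintro _ ⟨q, hq, rfl⟩
        simpa using hF q hq) (half_pos hε)
    refine ⟨m, fun i => Nat.casesOn i (Finsupp.single n 1) e, fun q hq => ?_⟩
    have h1 := he _ (Finset.mem_image_of_mem _ hq)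
    have h2 := hn q hq
    have h3 : q.2 + Finsupp.single n (q.1.headD 0) + comb e q.1.tail =
        q.2 + comb (fun i => Nat.casesOn i (Finsupp.single n 1) e) q.1 := by
      obtain ⟨_ | ⟨a, l⟩, v⟩ := q
      · simp [comb]
      · simp [comb, add_assoc]
    rw [h3] at h1
    have := abs_sub_le ‖T m (q.2 + comb (fun i => Nat.casesOn i (Finsupp.single n 1) e) q.1)‖
      (iterLim T q.1.tail (q.2 + Finsupp.single n (q.1.headD 0))) (iterLim T q.1 q.2)
    linarith

omit hp hupper hlower in
lemma map_comb {Y : Type*} [AddCommGroup Y] [Module ℝ Y] (f : Y →ₗ[ℝ] X) (y : ℕ → Y)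
    (l : List ℝ) : f (comb y l) = comb (fun i => f (y i)) l := by
  induction l generalizing y with
  | nil => simp [comb]
  | cons a l ih => simp [comb, ih]

theorem isSpreading_iterLim : IsSpreading p C X fun l => iterLim T l 0 where
  congr_nz {l l'} h := by rw [← iterLim_nz l, h, iterLim_nz]
  lipschitz h := by simpa [finsuppPSum] using iterLim_lipschitz hp hupper hlower h 0 0
  lower l := by simpa [finsuppPSum] using (iterLim_mem hp hupper hlower l 0).1
  homog c l := by simpa using iterLim_smul hp hupper hlower c l 0
  rep F ε hε := by
    classical
    obtain ⟨m, e, h⟩ := iterLim_rep hp hupper hlower (F.sup List.length)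
      (F.image fun l => (l, 0)) (by
        simp only [Finset.mem_image]
        rintro _ ⟨l, hl, rfl⟩
        exact Finset.le_sup (f := List.length) hl) hε
    refine ⟨fun i => T m (e i), fun l hl => ?_⟩
    simpa [map_comb] using h _ (Finset.mem_image_of_mem _ hl)

end SpreadingModel

/-! ### Passing to blocks -/

/-- The list obtained by replacing every entry `a` of `l` by the block `a • w`. -/
def blockList (l w : List ℝ) : List ℝ := l.flatMap fun a => w.map (a * ·)

lemma blockList_cons (a : ℝ) (l w : List ℝ) :
    blockList (a :: l) w = w.map (a * ·) ++ blockList l w := rfl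

lemma blockList_append (l l' w : List ℝ) :
    blockList (l ++ l') w = blockList l w ++ blockList l' w := List.flatMap_append

lemma length_blockList (l w : List ℝ) : (blockList l w).length = l.length * w.length := by
  simp [blockList]

lemma pSum_blockList (p : ℝ) (l w : List ℝ) :
    pSum p (blockList l w) = pSum p l * pSum p w := by
  induction l with
  | nil => simp [blockList]
  | cons a l ih => rw [blockList_cons, pSum_append, ih, pSum_map_mul, pSum_cons, add_mul]

lemma blockList_map_mul (c : ℝ) (l w : List ℝ) :
    blockList (l.map (c * ·)) w = (blockList l w).map (c * ·) := by
  simp [blockList, List.flatMap_map, List.map_flatMap, mul_assoc, Function.comp_def]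

lemma zipWith_sub_blockList {l l' : List ℝ} (h : l.length = l'.length) (w : List ℝ) :
    List.zipWith (· - ·) (blockList l w) (blockList l' w) =
      blockList (List.zipWith (· - ·) l l') w := by
  induction l generalizing l' with
  | nil => simp [blockList]
  | cons a l ih =>
    obtain _ | ⟨a', l'⟩ := l'
    · simp at h
    rw [blockList_cons, blockList_cons, List.zipWith_append (by simp), ih (by simpa using h),
      List.zipWith_cons_cons, blockList_cons]
    simp [List.zipWith_map, List.zipWith_self, sub_mul]

lemma nz_blockList_nz (l w : List ℝ) : nz (blockList (nz l) w) = nz (blockList l w) := by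
  induction l with
  | nil => rfl
  | cons a l ih =>
    rcases eq_or_ne a 0 with rfl | ha
    · rw [nz_cons_zero, ih, blockList_cons, nz_append]
      simp [nz]
    · rw [nz_cons_of_ne ha, blockList_cons, blockList_cons, nz_append, nz_append, ih]

lemma comb_blockList {X : Type*} [AddCommGroup X] [Module ℝ X] (y : ℕ → X) (l w : List ℝ) :
    comb y (blockList l w) = comb (fun i => comb (fun j => y (i * w.length + j)) w) l := by
  induction l generalizing y with
  | nil => rfl
  | cons a l ih =>
    rw [blockList_cons, comb_append, comb_map_mul, ih]
    simp [comb, add_mul, add_comm, add_left_comm]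

namespace IsSpreading

variable {p C : ℝ} {X : Type*} [NormedAddCommGroup X] [NormedSpace ℝ X] {S : List ℝ → ℝ}

lemma upper (hS : IsSpreading p C X S) (l : List ℝ) : S l ≤ C * pSum p l ^ (1 / p) := by
  have h := hS.lipschitz (l := l) (l' := l.map (0 * ·)) (by simp)
  have h0 : List.zipWith (· - ·) l (l.map (0 * ·)) = l := by
    rw [List.zipWith_map_right, List.zipWith_self]
    simp
  rw [hS.homog, abs_zero, zero_mul, sub_zero, h0] at h
  exact (le_abs_self _).trans h

variable {w : ℕ → List ℝ}

lemma tendsto_block (hS : IsSpreading p C X S) (hw : ∀ M, pSum p (w M) = 1) (l : List ℝ) :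
    Tendsto (fun M => S (blockList l (w M))) (hyperfilter ℕ)
      (𝓝 (ulim fun M => S (blockList l (w M)))) := by
  refine tendsto_ulim (a := pSum p l ^ (1 / p)) (b := C * pSum p l ^ (1 / p))
    (.of_forall fun M => ?_)
  have h := pSum_blockList p l (w M)
  rw [hw, mul_one] at h
  rw [← h]
  exact ⟨hS.lower _, hS.upper _⟩

/-- Limits of blocks of a spreading functional form a spreading functional. -/
theorem block (hS : IsSpreading p C X S) (hw : ∀ M, pSum p (w M) = 1) :
    IsSpreading p C X fun l => ulim fun M => S (blockList l (w M)) where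
  congr_nz {l l'} h := by
    congr! 2 with M
    exact hS.congr_nz (by rw [← nz_blockList_nz l, h, nz_blockList_nz])
  lipschitz {l l'} h := by
    refine le_of_tendsto ((hS.tendsto_block hw l).sub (hS.tendsto_block hw l')).abs
      (.of_forall fun M => ?_)
    refine (hS.lipschitz (by simp [length_blockList, h])).trans_eq ?_
    rw [zipWith_sub_blockList h, pSum_blockList, hw, mul_one]
  lower l := by
    refine ge_of_tendsto (hS.tendsto_block hw l) (.of_forall fun M => ?_)
    simpa only [pSum_blockList, hw, mul_one] using hS.lower (blockList l (w M))
  homog c l := by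
    refine ulim_eq (((hS.tendsto_block hw l).const_mul |c|).congr fun M => ?_)
    rw [blockList_map_mul, hS.homog]
  rep F ε hε := by
    classical
    have : ∀ᶠ M in (hyperfilter ℕ : Filter ℕ), ∀ l ∈ F,
        |S (blockList l (w M)) - ulim fun M => S (blockList l (w M))| < ε / 2 :=
      (Filter.eventually_all_finset F).2 fun l _ =>
        (hS.tendsto_block hw l).eventually (Metric.ball_mem_nhds _ (half_pos hε))
    obtain ⟨M, hM⟩ := this.exists
    obtain ⟨y, hy⟩ := hS.rep (F.image fun l => blockList l (w M)) (half_pos hε)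
    refine ⟨fun i => comb (fun j => y (i * (w M).length + j)) (w M), fun l hl => ?_⟩
    have h1 := hy _ (Finset.mem_image_of_mem _ hl)
    have h2 := hM l hl
    rw [comb_blockList] at h1
    exact (abs_sub_le _ _ _).trans_lt ((add_lt_add h1 h2).trans_eq (add_halves ε))

end IsSpreading

/-! ### Invariance under changes of signs -/

/-- The alternating list `[b, -b, b, …]` of length `M`. -/
def altList : ℕ → ℝ → List ℝ
  | 0, _ => []
  | M + 1, b => b :: altList M (-b)

@[simp] lemma length_altList (M : ℕ) (b : ℝ) : (altList M b).length = M := by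
  induction M generalizing b with
  | zero => rfl
  | succ M ih => simp [altList, ih]

lemma altList_map_mul (M : ℕ) (b c : ℝ) : (altList M b).map (c * ·) = altList M (c * b) := by
  induction M generalizing b with
  | zero => rfl
  | succ M ih => simp [altList, ih]

lemma pSum_altList (p : ℝ) (M : ℕ) (b : ℝ) : pSum p (altList M b) = M * |b| ^ p := by
  induction M generalizing b with
  | zero => simp [altList]
  | succ M ih => simp only [altList, pSum_cons, ih, abs_neg]; push_cast; ring

lemma pSum_altList_shift {p : ℝ} (hp : 0 < p) (M : ℕ) (b : ℝ) :
    pSum p (List.zipWith (· - ·) (altList M b ++ [0]) (b :: altList M (-b))) = |b| ^ p := by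
  induction M generalizing b with
  | zero => simp [altList]
  | succ M ih => simpa [altList, Real.zero_rpow hp.ne'] using ih (-b)

lemma pSum_altList_shift_zero {p : ℝ} (hp : 0 < p) (M : ℕ) (b : ℝ) :
    pSum p (List.zipWith (· - ·) (altList (M + 1) b ++ [0]) (0 :: altList (M + 1) (-b))) =
      2 * |b| ^ p := by
  have := pSum_altList_shift hp M (-b)
  simp only [altList, List.cons_append, List.zipWith_cons_cons, pSum_cons, sub_zero] at this ⊢
  rw [this, abs_neg]
  ring

lemma pSum_zipWith_sub_self {p : ℝ} (hp : 0 < p) (l : List ℝ) :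
    pSum p (List.zipWith (· - ·) l l) = 0 := by
  rw [List.zipWith_self]
  induction l with
  | nil => rfl
  | cons a l ih => simpa [Real.zero_rpow hp.ne'] using ih

lemma IsSpreading.abs_sub_alt_le {p C : ℝ} {X : Type*} [NormedAddCommGroup X] [NormedSpace ℝ X]
    {S : List ℝ → ℝ} (hp : 0 < p) (hS : IsSpreading p C X S) (l₁ l₂ : List ℝ) (M : ℕ) (b : ℝ) :
    |S (l₁ ++ (altList (M + 1) b ++ l₂)) - S (l₁ ++ (altList (M + 1) (-b) ++ l₂))| ≤
      C * (2 * |b| ^ p) ^ (1 / p) := by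
  have h1 : S (l₁ ++ (altList (M + 1) b ++ l₂)) = S (l₁ ++ ((altList (M + 1) b ++ [0]) ++ l₂)) :=
    hS.congr_nz (by simp [nz])
  have h2 : S (l₁ ++ (altList (M + 1) (-b) ++ l₂)) =
      S (l₁ ++ ((0 :: altList (M + 1) (-b)) ++ l₂)) :=
    hS.congr_nz (by simp [nz])
  rw [h1, h2]
  refine (hS.lipschitz (by simp; omega)).trans_eq ?_
  rw [List.zipWith_append rfl, List.zipWith_append (by simp), pSum_append, pSum_append,
    pSum_zipWith_sub_self hp, pSum_zipWith_sub_self hp, pSum_altList_shift_zero hp, zero_add,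
    add_zero]

theorem IsSpreading.exists_abs {p C : ℝ} {X : Type*} [NormedAddCommGroup X] [NormedSpace ℝ X]
    {S : List ℝ → ℝ} (hp : 0 < p) (hS : IsSpreading p C X S) :
    ∃ S', IsSpreading p C X S' ∧ ∀ l, S' (l.map (|·|)) = S' l := by
  let c : ℕ → ℝ := fun M => ((M : ℝ) + 1)⁻¹ ^ (1 / p)
  have hcp : ∀ M, |c M| ^ p = ((M : ℝ) + 1)⁻¹ := fun M => by
    rw [abs_of_nonneg (by positivity), ← Real.rpow_mul (by positivity), one_div_mul_cancel hp.ne',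
      Real.rpow_one]
  let w : ℕ → List ℝ := fun M => altList (M + 1) (c M)
  have hw : ∀ M, pSum p (w M) = 1 := fun M => by
    rw [pSum_altList, hcp]
    push_cast
    exact mul_inv_cancel₀ (by positivity)
  have key : ∀ l₁ a l₂, ulim (fun M => S (blockList (l₁ ++ a :: l₂) (w M))) =
      ulim (fun M => S (blockList (l₁ ++ -a :: l₂) (w M))) := fun l₁ a l₂ => by
    have hlim : Tendsto (fun M : ℕ => C * (2 * (|a| ^ p * ((M : ℝ) + 1)⁻¹)) ^ (1 / p))
        (hyperfilter ℕ) (𝓝 0) := by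
      have h1 : Tendsto (fun M : ℕ => ((M : ℝ) + 1)⁻¹) atTop (𝓝 0) := by
        simpa using tendsto_one_div_add_atTop_nhds_zero_nat (𝕜 := ℝ)
      have h2 := (((h1.const_mul (|a| ^ p)).const_mul 2).rpow_const (p := 1 / p)
        (.inr (by positivity))).const_mul C
      rw [mul_zero, mul_zero, Real.zero_rpow (by positivity), mul_zero] at h2
      exact h2.mono_left Nat.hyperfilter_le_atTop
    have h := le_of_tendsto_of_tendsto ((hS.tendsto_block hw (l₁ ++ a :: l₂)).sub
      (hS.tendsto_block hw (l₁ ++ -a :: l₂))).abs hlim (.of_forall fun M => ?_)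
    · exact sub_eq_zero.1 (abs_nonpos_iff.1 h)
    · simp only [blockList_append, blockList_cons, w, altList_map_mul]
      rw [neg_mul]
      refine (hS.abs_sub_alt_le hp _ _ _ _).trans_eq ?_
      rw [abs_mul, Real.mul_rpow (abs_nonneg _) (abs_nonneg _), hcp]
  refine ⟨_, hS.block hw, fun l => ?_⟩
  suffices ∀ l₁ l₂ : List ℝ, ulim (fun M => S (blockList (l₁ ++ l₂.map (|·|)) (w M))) =
      ulim (fun M => S (blockList (l₁ ++ l₂) (w M))) from this [] l
  intro l₁ l₂
  induction l₂ generalizing l₁ with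
  | nil => rfl
  | cons a l₂ ih =>
    have h := ih (l₁ ++ [|a|])
    simp only [List.append_assoc, List.singleton_append] at h
    rw [List.map_cons, h]
    rcases abs_choice a with ha | ha
    · rw [ha]
    · rw [ha, key l₁ a l₂]

/-! ### Approximate eigenvectors of the duplication operators -/

/-- Sets of positive integers which are nearly invariant under multiplication by small integers. -/
lemma exists_folner (K : ℕ) {ε : ℝ} (hε : 0 < ε) :
    ∃ N : ℕ, N ≠ 0 ∧ ∀ n, 1 ≤ n → n ≤ K →
      ((symmDiff N.divisors (N.divisors.image (n * ·))).card : ℝ) ≤ ε * N.divisors.card := by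
  set k := K.factorial with hk
  have hk0 : k ≠ 0 := K.factorial_ne_zero
  have hcard : ∀ L : ℕ, ((k ^ (L + 1)).divisors.card : ℝ) =
      ∏ q ∈ k.primeFactors, (((L : ℝ) + 1) * k.factorization q + 1) := fun L => by
    rw [Nat.card_divisors (pow_ne_zero _ hk0), Nat.primeFactors_pow _ (by simp)]
    simp [Nat.factorization_pow]
  have hlim : Tendsto (fun L : ℕ => ((k ^ (L + 1 + 1)).divisors.card : ℝ) /
      (k ^ (L + 1)).divisors.card) atTop (𝓝 1) := by
    simp only [hcard, ← Finset.prod_div_distrib]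
    rw [show 𝓝 (1 : ℝ) = 𝓝 (∏ q ∈ k.primeFactors, 1) by rw [Finset.prod_const_one]]
    refine tendsto_finsetProd _ fun q _ => ?_
    rcases Nat.eq_zero_or_pos (k.factorization q) with h | h
    · simp [h]
    · have hv : (0 : ℝ) < k.factorization q := by exact_mod_cast h
      have h3 : Tendsto (fun L : ℕ =>
          1 + k.factorization q * (((L : ℝ) + 1) * k.factorization q + 1)⁻¹)
          atTop (𝓝 (1 + k.factorization q * 0)) := by
        refine Tendsto.const_add _ (Tendsto.const_mul _ ?_)
        refine tendsto_inv_atTop_zero.comp ?_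
        refine tendsto_atTop_add_const_right _ _ (Tendsto.atTop_mul_const hv ?_)
        exact tendsto_atTop_add_const_right _ _ tendsto_natCast_atTop_atTop
      rw [mul_zero, add_zero] at h3
      refine h3.congr fun L => ?_
      have : ((L : ℝ) + 1) * k.factorization q + 1 ≠ 0 := by positivity
      push_cast
      field_simp
      ring
  obtain ⟨L, hL⟩ := (hlim.eventually (gt_mem_nhds (show (1 : ℝ) < 1 + ε / 2 by linarith))).exists
  refine ⟨k ^ (L + 1), pow_ne_zero _ hk0, fun n hn1 hnK => ?_⟩
  set D := (k ^ (L + 1)).divisors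
  set D' := (k ^ (L + 1 + 1)).divisors
  have hD : (0 : ℝ) < D.card := by
    exact_mod_cast Finset.card_pos.2 ⟨1, by simp [D, hk0]⟩
  rw [div_lt_iff₀ hD] at hL
  have hcardn : (D.image (n * ·)).card = D.card :=
    Finset.card_image_of_injective _ fun a b h => Nat.eq_of_mul_eq_mul_left (by omega) h
  have hsub : D ∪ D.image (n * ·) ⊆ D' := by
    refine Finset.union_subset ?_ ?_
    · exact Nat.divisors_subset_of_dvd (pow_ne_zero _ hk0) (pow_dvd_pow _ (Nat.le_succ _))
    · intro e he
      obtain ⟨d, hd, rfl⟩ := Finset.mem_image.1 he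
      refine Nat.mem_divisors.2 ⟨?_, pow_ne_zero _ hk0⟩
      rw [pow_succ' k (L + 1)]
      exact mul_dvd_mul (Nat.dvd_factorial (by omega) hnK) (Nat.dvd_of_mem_divisors hd)
  have h1 : (symmDiff D (D.image (n * ·))).card + 2 * D.card = 2 * (D ∪ D.image (n * ·)).card := by
    have e1 := Finset.card_sdiff_add_card_inter D (D.image (n * ·))
    have e2 := Finset.card_sdiff_add_card_inter (D.image (n * ·)) D
    have e3 := Finset.card_union_add_card_inter D (D.image (n * ·))
    have e4 : (symmDiff D (D.image (n * ·))).card =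
        (D \ D.image (n * ·)).card + (D.image (n * ·) \ D).card :=
      Finset.card_union_of_disjoint disjoint_sdiff_sdiff
    rw [Finset.inter_comm] at e2
    omega
  have h2 := Finset.card_le_card hsub
  have h1' : ((symmDiff D (D.image (n * ·))).card : ℝ) + 2 * D.card =
    2 * (D ∪ D.image (n * ·)).card := by exact_mod_cast h1
  have h2' : ((D ∪ D.image (n * ·)).card : ℝ) ≤ D'.card := by exact_mod_cast h2
  linarith

lemma nz_flatMap_congr {α : Type*} {l : List α} {f g : α → List ℝ}
    (h : ∀ x ∈ l, nz (f x) = nz (g x)) : nz (l.flatMap f) = nz (l.flatMap g) := by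
  simp only [nz, List.filter_flatMap] at h ⊢
  exact List.flatMap_congr h

lemma nz_flatMap_range_mul {n : ℕ} (hn : 0 < n) (R : ℕ) {f : ℕ → List ℝ}
    (hf : ∀ x, ¬ n ∣ x → nz (f x) = []) :
    nz ((List.range (n * R)).flatMap f) = nz ((List.range R).flatMap fun y => f (n * y)) := by
  induction R with
  | zero => simp
  | succ R ih =>
    rw [Nat.mul_succ, List.range_add, List.range_succ, List.flatMap_append, List.flatMap_append,
      nz_append, nz_append, ih]
    congr 1
    obtain ⟨m, rfl⟩ : ∃ m, n = m + 1 := ⟨n - 1, by omega⟩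
    rw [List.range_succ_eq_map, List.map_cons, List.flatMap_cons, nz_append, List.map_map,
      List.flatMap_map]
    have : nz ((List.range m).flatMap fun a => f ((m + 1) * R + (a + 1))) =
        nz ((List.range m).flatMap fun _ => []) :=
      nz_flatMap_congr fun a ha => hf _ fun hd => by
        have h1 := (Nat.dvd_add_right (Dvd.intro _ rfl)).1 hd
        have h2 := Nat.le_of_dvd (Nat.succ_pos _) h1
        have h3 := List.mem_range.1 ha
        omega
    rw [List.flatMap_eq_nil_iff.2 fun _ _ => rfl] at this
    simpa using this

lemma nz_map_range_mul {n : ℕ} (hn : 0 < n) (W : ℕ) {f : ℕ → ℝ} (hf : ∀ x, ¬ n ∣ x → f x = 0) :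
    nz ((List.range (n * W)).map f) = nz ((List.range W).map fun y => f (n * y)) := by
  have := nz_flatMap_range_mul hn W (f := fun x => [f x]) fun x hx => by simp [nz, hf x hx]
  simpa only [List.map_eq_flatMap] using this

lemma nz_map_range_of_le {W W' : ℕ} (h : W ≤ W') {f : ℕ → ℝ} (hf : ∀ x, W ≤ x → f x = 0) :
    nz ((List.range W').map f) = nz ((List.range W).map f) := by
  obtain ⟨m, rfl⟩ := Nat.exists_eq_add_of_le h
  rw [List.range_add, List.map_append, nz_append, List.map_map]
  simp [nz, hf]

lemma flatMap_range_mul_of_periodic {α : Type*} (n R : ℕ) {f : ℕ → List α}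
    (hf : ∀ k x, f (R * k + x) = f x) :
    (List.range (n * R)).flatMap f = (List.replicate n ((List.range R).flatMap f)).flatten := by
  induction n with
  | zero => simp
  | succ n ih =>
    rw [Nat.succ_mul, List.range_add, List.flatMap_append, ih, List.flatMap_map,
      List.replicate_succ', List.flatten_append]
    simp [mul_comm n R, hf]

lemma pSum_flatMap_range (p : ℝ) (R : ℕ) (f : ℕ → List ℝ) :
    pSum p ((List.range R).flatMap f) = ∑ x ∈ Finset.range R, pSum p (f x) := by
  induction R with
  | zero => simp
  | succ R ih => simp [List.range_succ, Finset.sum_range_succ, ih]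

lemma pSum_map_range (p : ℝ) (W : ℕ) (f : ℕ → ℝ) :
    pSum p ((List.range W).map f) = ∑ e ∈ Finset.range W, |f e| ^ p := by
  simpa [List.map_eq_flatMap] using pSum_flatMap_range p W fun e => [f e]

lemma zipWith_flatMap {α : Type*} (l : List α) {f g : α → List ℝ}
    (h : ∀ x, (f x).length = (g x).length) :
    List.zipWith (· - ·) (l.flatMap f) (l.flatMap g) =
      l.flatMap fun x => List.zipWith (· - ·) (f x) (g x) := by
  induction l with
  | nil => rfl
  | cons a l ih => simp only [List.flatMap_cons, List.zipWith_append (h a), ih]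

lemma card_filter_dvd_mul {R e : ℕ} (hR : R ≠ 0) (he : e ∣ R) :
    ((Finset.range R).filter fun x => R ∣ e * x).card = e := by
  obtain ⟨m, rfl⟩ := he
  have he0 : 0 < e := Nat.pos_of_ne_zero (left_ne_zero_of_mul hR)
  have hm0 : 0 < m := Nat.pos_of_ne_zero (right_ne_zero_of_mul hR)
  have : (Finset.range (e * m)).filter (fun x => e * m ∣ e * x) =
      (Finset.range e).image (m * ·) := by
    ext x
    simp only [Finset.mem_filter, Finset.mem_range, Finset.mem_image,
      Nat.mul_dvd_mul_iff_left he0]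
    constructor
    · rintro ⟨hx, y, rfl⟩
      exact ⟨y, by rw [mul_comm e m] at hx; exact lt_of_mul_lt_mul_left hx (Nat.zero_le _), rfl⟩
    · rintro ⟨y, hy, rfl⟩
      exact ⟨by rw [mul_comm e m]; exact Nat.mul_lt_mul_of_pos_left hy hm0, Dvd.intro _ rfl⟩
  rw [this, Finset.card_image_of_injective _ fun a b h => Nat.eq_of_mul_eq_mul_left hm0 h,
    Finset.card_range]

/-- The entry with label `e` at the position `x / R`: it equals `(c / e)^{1/p}` if `e ∈ E` and
`x / R` is a multiple of `1 / e`. -/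
def gridFun (p : ℝ) (R : ℕ) (E : Finset ℕ) (c : ℝ) (x e : ℕ) : ℝ :=
  if e ∈ E ∧ R ∣ e * x then (c / e) ^ (1 / p) else 0

/-- The values of `gridFun`, ordered lexicographically by position and label. -/
def gridList (p : ℝ) (R W : ℕ) (E : Finset ℕ) (c : ℝ) : List ℝ :=
  (List.range R).flatMap fun x => (List.range W).map (gridFun p R E c x)

section grid

variable {p : ℝ}

lemma pSum_gridList (hp : 0 < p) {R W : ℕ} (hR : R ≠ 0) {E : Finset ℕ}
    (hE : ∀ e ∈ E, e ∣ R ∧ e < W) : pSum p (gridList p R W E 1) = E.card := by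
  rw [gridList, pSum_flatMap_range]
  simp only [pSum_map_range]
  rw [Finset.sum_comm]
  have h : ∀ e ∈ Finset.range W, ∑ x ∈ Finset.range R, |gridFun p R E 1 x e| ^ p =
      if e ∈ E then 1 else 0 := fun e _ => by
    by_cases he : e ∈ E
    · have he0 : (e : ℝ) ≠ 0 := by
        have := ne_zero_of_dvd_ne_zero hR (hE e he).1
        exact_mod_cast this
      have : ∀ x, |gridFun p R E 1 x e| ^ p = if R ∣ e * x then 1 / (e : ℝ) else 0 := fun x => by
        by_cases hx : R ∣ e * x
        · simp only [gridFun, he, hx, and_self, if_true]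
          rw [abs_of_nonneg (by positivity), ← Real.rpow_mul (by positivity),
            one_div_mul_cancel hp.ne', Real.rpow_one]
        · simp [gridFun, hx, Real.zero_rpow hp.ne']
      simp only [this, ← Finset.sum_filter, Finset.sum_const, card_filter_dvd_mul hR (hE e he).1,
        he, if_true, nsmul_eq_mul]
      field_simp
    · simp [gridFun, he, Real.zero_rpow hp.ne']
  rw [Finset.sum_congr rfl h, ← Finset.sum_filter, Finset.sum_const, nsmul_eq_mul, mul_one]
  congr 2
  ext e
  simpa using fun he => (hE e he).2

lemma pSum_zipWith_gridList (hp : 0 < p) {R W : ℕ} (hR : R ≠ 0) {E E' : Finset ℕ} {c : ℝ}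
    (hc : 0 ≤ c) (hE : ∀ e ∈ E ∪ E', e ∣ R) :
    pSum p (List.zipWith (· - ·) (gridList p R W E c) (gridList p R W E' c)) ≤
      c * (symmDiff E E').card := by
  rw [gridList, gridList, zipWith_flatMap _ (by simp), pSum_flatMap_range]
  simp only [List.zipWith_map, List.zipWith_self, pSum_map_range]
  rw [Finset.sum_comm]
  have h : ∀ e ∈ Finset.range W,
      ∑ x ∈ Finset.range R, |gridFun p R E c x e - gridFun p R E' c x e| ^ p =
        if e ∈ symmDiff E E' then c else 0 := fun e _ => by
    by_cases he : e ∈ symmDiff E E'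
    · have heR : e ∣ R := hE e (by
        rcases Finset.mem_symmDiff.1 he with h | h <;> simp [h.1])
      have he0 : (e : ℝ) ≠ 0 := by
        have := ne_zero_of_dvd_ne_zero hR heR
        exact_mod_cast this
      have : ∀ x, |gridFun p R E c x e - gridFun p R E' c x e| ^ p =
          if R ∣ e * x then c / (e : ℝ) else 0 := fun x => by
        by_cases hx : R ∣ e * x
        · have h1 : |(c / e) ^ (1 / p)| ^ p = c / e := by
            rw [abs_of_nonneg (by positivity), ← Real.rpow_mul (by positivity),
              one_div_mul_cancel hp.ne', Real.rpow_one]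
          rcases Finset.mem_symmDiff.1 he with h | h
          · simpa only [gridFun, h, hx, and_self, and_true, if_true, if_false, sub_zero] using h1
          · simpa only [gridFun, h, hx, and_self, and_true, if_true, if_false, zero_sub, abs_neg]
              using h1
        · simp [gridFun, hx, Real.zero_rpow hp.ne']
      simp only [this, ← Finset.sum_filter, Finset.sum_const, card_filter_dvd_mul hR heR,
        he, if_true, nsmul_eq_mul]
      field_simp
    · have hiff : e ∈ E ↔ e ∈ E' := by
        rw [Finset.mem_symmDiff] at he
        tauto
      simp [gridFun, he, hiff, Real.zero_rpow hp.ne']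
  rw [Finset.sum_congr rfl h, ← Finset.sum_filter, Finset.sum_const, nsmul_eq_mul, mul_comm]
  gcongr
  exact fun e he => (Finset.mem_filter.1 he).2

lemma nz_gridList_dilate {R W n : ℕ} (hn : 0 < n) (hR : R ≠ 0) {E : Finset ℕ}
    (hE : ∀ e ∈ E, e ∣ R ∧ e < W) :
    nz (gridList p (n * R) (n * W) E n) =
      nz ((gridList p R W E 1).map ((n : ℝ) ^ (1 / p) * ·)) := by
  rw [gridList, nz_flatMap_range_mul hn, gridList, List.map_flatMap]
  · refine nz_flatMap_congr fun y _ => ?_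
    rw [nz_map_range_of_le (Nat.le_mul_of_pos_left W hn), List.map_map]
    · congr 2
      ext e
      have : n * R ∣ e * (n * y) ↔ R ∣ e * y := by
        rw [mul_left_comm, Nat.mul_dvd_mul_iff_left hn]
      simp only [gridFun, this, Function.comp]
      split_ifs
      · rw [← Real.mul_rpow (by positivity) (by positivity), mul_one_div]
      · simp
    · exact fun e he => if_neg fun h => absurd (hE e h.1).2 (not_lt.2 he)
  · intro x hx
    have : ∀ e, gridFun p (n * R) E n x e = 0 := fun e => if_neg fun h => hx <| by
      obtain ⟨k, rfl⟩ := (hE e h.1).1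
      have he : 0 < e := Nat.pos_of_ne_zero (left_ne_zero_of_mul hR)
      have h2 := h.2
      rw [mul_left_comm, Nat.mul_dvd_mul_iff_left he] at h2
      exact (Dvd.intro _ rfl).trans h2
    simp [nz, this]

lemma nz_gridList_replicate {R W n : ℕ} (hn : 0 < n) (E : Finset ℕ) :
    nz (gridList p (n * R) (n * W) (E.image (n * ·)) n) =
      nz (List.replicate n (gridList p R W E 1)).flatten := by
  rw [gridList, gridList, ← flatMap_range_mul_of_periodic]
  · refine nz_flatMap_congr fun y _ => ?_
    rw [nz_map_range_mul hn]
    · congr 2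
      ext d
      have h1 : n * d ∈ E.image (n * ·) ↔ d ∈ E :=
        (mul_right_injective₀ hn.ne').mem_finset_image
      have h2 : n * R ∣ n * d * y ↔ R ∣ d * y := by
        rw [mul_assoc, Nat.mul_dvd_mul_iff_left hn]
      simp only [gridFun, h1, h2]
      congr 2
      push_cast
      field_simp
    · exact fun e he => if_neg fun h => he <| by
        obtain ⟨d, -, rfl⟩ := Finset.mem_image.1 h.1
        exact Dvd.intro _ rfl
  · intro k x
    congr 1
    ext e
    have : R ∣ e * (R * k + x) ↔ R ∣ e * x := by
      rw [mul_add, Nat.dvd_add_right ((Dvd.intro _ rfl).mul_left e)]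
    simp only [gridFun, this]

end grid

lemma zipWith_sub_map_mul (c : ℝ) (l l' : List ℝ) :
    List.zipWith (· - ·) (l.map (c * ·)) (l'.map (c * ·)) =
      (List.zipWith (· - ·) l l').map (c * ·) := by
  simp [List.zipWith_map, List.map_zipWith, mul_sub]

lemma nz_map_mul {c : ℝ} (hc : c ≠ 0) (l : List ℝ) :
    nz (l.map (c * ·)) = (nz l).map (c * ·) := by
  simp [nz, List.filter_map, Function.comp_def, hc]

lemma exists_approx_eigenvector {p : ℝ} (hp : 0 < p) (K : ℕ) {ε : ℝ} (hε : 0 < ε) :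
    ∃ u : List ℝ, pSum p u = 1 ∧ ∀ n : ℕ, 1 ≤ n → n ≤ K → ∃ A B : List ℝ,
      A.length = B.length ∧ nz A = nz (u.map ((n : ℝ) ^ (1 / p) * ·)) ∧
      nz B = nz (List.replicate n u).flatten ∧ pSum p (List.zipWith (· - ·) A B) ≤ ε := by
  obtain ⟨N, hN, h⟩ := exists_folner K (ε := ε / (K + 1)) (by positivity)
  set E := N.divisors
  have hE : ∀ e ∈ E, e ∣ N ∧ e < N + 1 := fun e he =>
    ⟨Nat.dvd_of_mem_divisors he, Nat.lt_succ_of_le (Nat.divisor_le he)⟩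
  have hEc : (0 : ℝ) < E.card := by exact_mod_cast Finset.card_pos.2 ⟨1, by simp [E, hN]⟩
  set c : ℝ := (E.card : ℝ)⁻¹ ^ (1 / p) with hc
  have hc0 : c ≠ 0 := (Real.rpow_pos_of_pos (by positivity) _).ne'
  have hcp : |c| ^ p = (E.card : ℝ)⁻¹ := by
    rw [abs_of_nonneg (by positivity), ← Real.rpow_mul (by positivity), one_div_mul_cancel hp.ne',
      Real.rpow_one]
  refine ⟨(gridList p N (N + 1) E 1).map (c * ·), ?_, fun n hn1 hnK =>
    ⟨(gridList p (n * N) (n * (N + 1)) E n).map (c * ·),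
      (gridList p (n * N) (n * (N + 1)) (E.image (n * ·)) n).map (c * ·), ?_, ?_, ?_, ?_⟩⟩
  · rw [pSum_map_mul, pSum_gridList hp hN hE, hcp, inv_mul_cancel₀ hEc.ne']
  · simp [gridList]
  · rw [nz_map_mul hc0, nz_gridList_dilate hn1 hN hE, ← nz_map_mul hc0]
    simp [mul_left_comm, Function.comp_def]
  · rw [nz_map_mul hc0, nz_gridList_replicate hn1, ← nz_map_mul hc0, List.map_flatten,
      List.map_replicate]
  · rw [zipWith_sub_map_mul, pSum_map_mul, hcp, inv_mul_le_iff₀ hEc]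
    refine (pSum_zipWith_gridList hp (mul_ne_zero (by omega) hN) n.cast_nonneg ?_).trans ?_
    · intro e he
      rcases Finset.mem_union.1 he with he | he
      · exact (hE e he).1.mul_left n
      · obtain ⟨d, hd, rfl⟩ := Finset.mem_image.1 he
        exact mul_dvd_mul_left n (hE d hd).1
    · have hnK' : (n : ℝ) ≤ K + 1 := by exact_mod_cast hnK.trans (Nat.le_succ K)
      calc (n : ℝ) * (symmDiff E (E.image (n * ·))).card
          ≤ (K + 1) * (ε / (K + 1) * E.card) := by
            gcongr
            exact h n hn1 hnK
        _ = E.card * ε := by field_simp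

/-! ### Krivine's theorem -/

lemma map_abs_blockList (l w : List ℝ) :
    (blockList (l.map (|·|)) w).map (|·|) = (blockList l w).map (|·|) := by
  simp [blockList, List.flatMap_map, List.map_flatMap, abs_mul, Function.comp_def]

lemma blockList_replicate_one (n : ℕ) (w : List ℝ) :
    blockList (List.replicate n 1) w = (List.replicate n w).flatten := by
  simp [blockList, List.flatMap_replicate]

namespace IsSpreading

variable {p C : ℝ} {X : Type*} [NormedAddCommGroup X] [NormedSpace ℝ X] {S : List ℝ → ℝ}

lemma nil_eq_zero (hS : IsSpreading p C X S) : S [] = 0 := by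
  simpa using hS.homog 0 []

lemma eq_replicate_sum (hp : 0 < p) (hS : IsSpreading p C X S)
    (h : ∀ (n : ℕ) (l₁ l₂ : List ℝ), 1 ≤ n →
      S (l₁ ++ (n : ℝ) ^ (1 / p) :: l₂) = S (l₁ ++ (List.replicate n 1 ++ l₂)))
    (ns : List ℕ) (l : List ℝ) :
    S (l ++ ns.map fun n : ℕ => (n : ℝ) ^ (1 / p)) = S (l ++ List.replicate ns.sum 1) := by
  induction ns generalizing l with
  | nil => simp
  | cons n ns ih =>
    have := ih (l ++ [(n : ℝ) ^ (1 / p)])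
    rw [List.append_assoc, List.append_assoc, List.singleton_append, List.singleton_append] at this
    rw [List.map_cons, this, List.sum_cons]
    rcases Nat.eq_zero_or_pos n with rfl | hn
    · exact hS.congr_nz (by simp [nz_cons_zero, Real.zero_rpow (inv_pos.2 hp).ne'])
    · rw [h n _ _ hn, List.replicate_add]

lemma eq_mul_sum (hp : 0 < p) (hS : IsSpreading p C X S)
    (h : ∀ (n : ℕ) (l₁ l₂ : List ℝ), 1 ≤ n →
      S (l₁ ++ (n : ℝ) ^ (1 / p) :: l₂) = S (l₁ ++ (List.replicate n 1 ++ l₂)))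
    (ns : List ℕ) :
    S (ns.map fun n : ℕ => (n : ℝ) ^ (1 / p)) = (ns.sum : ℝ) ^ (1 / p) * S [1] := by
  have h1 := hS.eq_replicate_sum hp h ns []
  rw [List.nil_append, List.nil_append] at h1
  rw [h1]
  rcases Nat.eq_zero_or_pos ns.sum with h0 | h0
  · rw [h0]
    simp [hS.nil_eq_zero, Real.zero_rpow (inv_pos.2 hp).ne']
  · have h2 := h ns.sum [] [] h0
    simp only [List.nil_append, List.append_nil] at h2
    have h3 := hS.homog ((ns.sum : ℝ) ^ (1 / p)) [1]
    rw [abs_of_nonneg (by positivity), List.map_singleton, mul_one] at h3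
    rw [← h2, h3]

/-- A spreading functional is a multiple of the `ℓ_p` norm if it is invariant under changes of
signs and under the replacement of an entry `n^{1/p}` by `n` ones. -/
lemma eq_mul_pSum (hp : 0 < p) (hS : IsSpreading p C X S) (habs : ∀ l, S (l.map (|·|)) = S l)
    (h : ∀ (n : ℕ) (l₁ l₂ : List ℝ), 1 ≤ n →
      S (l₁ ++ (n : ℝ) ^ (1 / p) :: l₂) = S (l₁ ++ (List.replicate n 1 ++ l₂)))
    (l : List ℝ) : S l = pSum p l ^ (1 / p) * S [1] := by
  have hp' : 0 < 1 / p := by positivity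
  let q : ℝ → ℕ → ℝ := fun a N => (⌊|a| ^ p * (N : ℝ)⌋₊ : ℝ) / N
  have hq : ∀ a, Tendsto (q a) atTop (𝓝 (|a| ^ p)) := fun a =>
    (tendsto_nat_floor_mul_div_atTop (R := ℝ) (by positivity)).comp tendsto_natCast_atTop_atTop
  have hSq : ∀ᶠ N in atTop, S (l.map fun a => q a N ^ (1 / p)) =
      (l.map fun a => q a N).sum ^ (1 / p) * S [1] := by
    filter_upwards [eventually_ge_atTop 1] with N hN
    have hN0 : (0 : ℝ) < N := by exact_mod_cast hN
    have h1 := hS.eq_mul_sum hp h (l.map fun a => ⌊|a| ^ p * (N : ℝ)⌋₊)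
    have h2 := hS.homog ((N : ℝ)⁻¹ ^ (1 / p))
      ((l.map fun a => ⌊|a| ^ p * (N : ℝ)⌋₊).map fun n : ℕ => (n : ℝ) ^ (1 / p))
    rw [h1, abs_of_nonneg (by positivity), ← mul_assoc, ← Real.mul_rpow (by positivity)
      (by positivity), List.map_map, List.map_map] at h2
    convert h2 using 2
    · congr! 2 with a
      simp only [q, Function.comp]
      rw [← Real.mul_rpow (by positivity) (by positivity), div_eq_inv_mul]
    · congr 1
      simp only [q, div_eq_inv_mul, List.sum_map_mul_left, Nat.cast_list_sum, List.map_map,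
        Function.comp_def]
  have hlim1 : Tendsto (fun N => S (l.map fun a => q a N ^ (1 / p))) atTop (𝓝 (S l)) := by
    rw [← habs l, tendsto_iff_norm_sub_tendsto_zero]
    have hb : Tendsto (fun N => C * (l.map fun a => |q a N ^ (1 / p) - abs a| ^ p).sum ^ (1 / p))
        atTop (𝓝 (C * (l.map fun _ => (0 : ℝ)).sum ^ (1 / p))) := by
      refine ((tendsto_list_sum l fun a _ => ?_).rpow_const (Or.inr hp'.le)).const_mul C
      have h1 : Tendsto (fun N => q a N ^ (1 / p)) atTop (𝓝 |a|) := by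
        have := (hq a).rpow_const (p := 1 / p) (Or.inr hp'.le)
        rwa [← Real.rpow_mul (abs_nonneg a), mul_one_div_cancel hp.ne', Real.rpow_one] at this
      have h2 := ((h1.sub_const |a|).abs).rpow_const (p := p) (Or.inr hp.le)
      simpa [Real.zero_rpow hp.ne'] using h2
    have h0 : C * (l.map fun _ => (0 : ℝ)).sum ^ (1 / p) = 0 := by
      simp [Real.zero_rpow (inv_pos.2 hp).ne']
    rw [h0] at hb
    refine squeeze_zero (fun _ => norm_nonneg _) (fun N => ?_) hb
    refine (hS.lipschitz (by simp)).trans_eq ?_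
    rw [List.zipWith_map, List.zipWith_self, pSum, List.map_map]
    rfl
  have hlim2 : Tendsto (fun N => (l.map fun a => q a N).sum ^ (1 / p) * S [1]) atTop
      (𝓝 (pSum p l ^ (1 / p) * S [1])) :=
    ((tendsto_list_sum l fun a _ => hq a).rpow_const (Or.inr hp'.le)).mul_const _
  exact tendsto_nhds_unique (hlim1.congr' hSq) hlim2

lemma abs_sub_block_le (hp : 0 < p) (hS : IsSpreading p C X S) {n : ℕ} {u A B : List ℝ}
    (hAB : A.length = B.length) (hA : nz A = nz (u.map ((n : ℝ) ^ (1 / p) * ·)))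
    (hB : nz B = nz (List.replicate n u).flatten) (l₁ l₂ : List ℝ) :
    |S (blockList (l₁ ++ (n : ℝ) ^ (1 / p) :: l₂) u) -
        S (blockList (l₁ ++ (List.replicate n 1 ++ l₂)) u)| ≤
      C * pSum p (List.zipWith (· - ·) A B) ^ (1 / p) := by
  have h1 : S (blockList (l₁ ++ (n : ℝ) ^ (1 / p) :: l₂) u) =
      S (blockList l₁ u ++ (A ++ blockList l₂ u)) :=
    hS.congr_nz (by simp only [blockList_append, blockList_cons, nz_append, hA])
  have h2 : S (blockList (l₁ ++ (List.replicate n 1 ++ l₂)) u) =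
      S (blockList l₁ u ++ (B ++ blockList l₂ u)) :=
    hS.congr_nz (by simp only [blockList_append, blockList_replicate_one, nz_append, hB])
  rw [h1, h2]
  refine (hS.lipschitz (by simp [hAB])).trans_eq ?_
  rw [List.zipWith_append rfl, List.zipWith_append hAB, pSum_append, pSum_append,
    pSum_zipWith_sub_self hp, pSum_zipWith_sub_self hp, zero_add, add_zero]

/-- Blocks of a spreading functional that is invariant under changes of signs approximate the
norm of `ℓ_p`. -/
theorem exists_eq_mul_pSum (hp : 0 < p) (hS : IsSpreading p C X S)
    (habs : ∀ l, S (l.map (|·|)) = S l) :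
    ∃ S', IsSpreading p C X S' ∧ ∀ l, S' l = pSum p l ^ (1 / p) * S' [1] := by
  choose u hu hAB using fun M : ℕ =>
    exists_approx_eigenvector hp M (ε := 1 / ((M : ℝ) + 1)) (by positivity)
  have hS' := hS.block hu
  refine ⟨_, hS', hS'.eq_mul_pSum hp (fun l => ?_) fun n l₁ l₂ hn => ?_⟩
  · congr! 2 with M
    rw [← habs, map_abs_blockList, habs]
  · have hlim := ((hS.tendsto_block hu (l₁ ++ (n : ℝ) ^ (1 / p) :: l₂)).sub
      (hS.tendsto_block hu (l₁ ++ (List.replicate n 1 ++ l₂))))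
    have h0 : Tendsto (fun M => S (blockList (l₁ ++ (n : ℝ) ^ (1 / p) :: l₂) (u M)) -
        S (blockList (l₁ ++ (List.replicate n 1 ++ l₂)) (u M))) (hyperfilter ℕ) (𝓝 0) := by
      have hb : Tendsto (fun M : ℕ => C * (1 / ((M : ℝ) + 1)) ^ (1 / p)) (hyperfilter ℕ)
          (𝓝 0) := by
        have := (tendsto_one_div_add_atTop_nhds_zero_nat (𝕜 := ℝ)).rpow_const (p := 1 / p)
          (Or.inr (by positivity))
        rw [Real.zero_rpow (by positivity)] at this
        simpa using (this.const_mul C).mono_left Nat.hyperfilter_le_atTop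
      refine squeeze_zero_norm' ?_ hb
      filter_upwards [eventually_hyperfilter_ge n] with M hM
      obtain ⟨A, B, hlen, hA, hB, hle⟩ := hAB M n hn hM
      refine (hS.abs_sub_block_le hp hlen hA hB l₁ l₂).trans ?_
      have hC : 0 ≤ C := by
        have h1 := (hS.lower [1]).trans (hS.upper [1])
        simp at h1
        linarith
      have := pSum_nonneg p (List.zipWith (· - ·) A B)
      gcongr
    exact sub_eq_zero.1 (tendsto_nhds_unique hlim h0)

end IsSpreading

section Krivine

variable {p : ℝ} {X : Type*} [NormedAddCommGroup X] [NormedSpace ℝ X]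

lemma exists_isSpreading [Fact (1 ≤ ENNReal.ofReal p)] (hp : 0 < p)
    (hX : UnifContainsLp (ENNReal.ofReal p) X) : ∃ C S, IsSpreading p C X S := by
  obtain ⟨C, hC, h⟩ := hX
  choose Y T hT using h
  let r : ∀ m, (ℕ →₀ ℝ) →ₗ[ℝ] PiLp (ENNReal.ofReal p) (fun _ : Fin m => ℝ) := fun m =>
    (WithLp.linearEquiv _ ℝ (Fin m → ℝ)).symm.toLinearMap ∘ₗ
      LinearMap.pi fun i : Fin m => Finsupp.lapply (i : ℕ)
  have hr : ∀ m v, ‖r m v‖ = (∑ i ∈ Finset.range m, |v i| ^ p) ^ (1 / p) := fun m v => by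
    have hp' : (ENNReal.ofReal p).toReal = p := ENNReal.toReal_ofReal hp.le
    rw [PiLp.norm_eq_sum (by rw [hp']; exact hp), hp', Finset.sum_range]
    rfl
  have hzero : ∀ (v : ℕ →₀ ℝ) i, i ∉ v.support → |v i| ^ p = 0 := fun v i hi => by
    rw [Finsupp.notMem_support_iff.1 hi, abs_zero, Real.zero_rpow hp.ne']
  let c : ℕ → ℝ := fun m =>
    ‖((T m).symm : Y m →L[ℝ] PiLp (ENNReal.ofReal p) (fun _ : Fin m => ℝ))‖
  let T' : ℕ → (ℕ →₀ ℝ) →ₗ[ℝ] X := fun m =>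
    c m • ((Y m).subtype ∘ₗ (T m).toLinearEquiv.toLinearMap ∘ₗ r m)
  have hT' : ∀ m v, ‖T' m v‖ = c m * ‖T m (r m v)‖ := fun m v => by
    have hc : 0 ≤ c m := norm_nonneg
      ((T m).symm : Y m →L[ℝ] PiLp (ENNReal.ofReal p) (fun _ : Fin m => ℝ))
    simp [T', norm_smul, abs_of_nonneg hc]
  refine ⟨C, _, isSpreading_iterLim (T := T') (C := C) hp (fun m v => ?_) fun v => ?_⟩
  · have h1 : ‖r m v‖ ≤ finsuppPSum p v ^ (1 / p) := by
      rw [hr]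
      have : ∑ i ∈ Finset.range m, |v i| ^ p ≤ finsuppPSum p v := by
        rw [← Finset.sum_filter_add_sum_filter_not _ (· ∈ v.support),
          Finset.sum_eq_zero (s := (Finset.range m).filter (· ∉ v.support)) fun i hi =>
            hzero v i (Finset.mem_filter.1 hi).2, add_zero]
        exact Finset.sum_le_sum_of_subset_of_nonneg
          (fun i hi => (Finset.mem_filter.1 hi).2) fun _ _ _ => by positivity
      have h0 : 0 ≤ ∑ i ∈ Finset.range m, |v i| ^ p :=
        Finset.sum_nonneg fun _ _ => by positivity
      gcongr
    rw [hT']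
    calc c m * ‖T m (r m v)‖
        ≤ c m * (‖(T m : PiLp (ENNReal.ofReal p) (fun _ : Fin m => ℝ) →L[ℝ] Y m)‖ * ‖r m v‖) := by
          gcongr
          exact ContinuousLinearMap.le_opNorm
            (T m : PiLp (ENNReal.ofReal p) (fun _ : Fin m => ℝ) →L[ℝ] Y m) _
      _ ≤ C * finsuppPSum p v ^ (1 / p) := by
          rw [← mul_assoc, mul_comm (c m)]
          exact mul_le_mul (hT m) h1 (norm_nonneg _) (zero_le_one.trans hC)
  · filter_upwards [eventually_hyperfilter_ge (v.support.sup id + 1)] with m hm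
    have h1 : finsuppPSum p v ^ (1 / p) = ‖r m v‖ := by
      rw [hr]
      congr 1
      refine Finset.sum_subset (fun i hi => ?_) fun i _ hi => hzero v i hi
      exact Finset.mem_range.2 ((Nat.lt_succ_of_le (Finset.le_sup (f := id) hi)).trans_le hm)
    rw [h1, hT']
    simpa using ContinuousLinearMap.le_opNorm
      ((T m).symm : Y m →L[ℝ] PiLp (ENNReal.ofReal p) (fun _ : Fin m => ℝ)) (T m (r m v))

/-- Krivine's theorem for spaces uniformly containing `ℓ_p^m`, for finitely many vectors. -/
theorem exists_abs_norm_sub_lt [Fact (1 ≤ ENNReal.ofReal p)] (hp : 0 < p)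
    (hX : UnifContainsLp (ENNReal.ofReal p) X) {ι : Type*} [Fintype ι] (F : Finset (ι → ℝ))
    {ε : ℝ} (hε : 0 < ε) :
    ∃ y : ι → X, ∀ a ∈ F, |‖∑ i, a i • y i‖ - (∑ i, |a i| ^ p) ^ (1 / p)| < ε := by
  classical
  obtain ⟨C, S₀, hS₀⟩ := exists_isSpreading hp hX
  obtain ⟨S₁, hS₁, habs⟩ := hS₀.exists_abs hp
  obtain ⟨S, hS, hSp⟩ := hS₁.exists_eq_mul_pSum hp habs
  have hS1 : 1 ≤ S [1] := by simpa using hS.lower [1]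
  let e := Fintype.equivFin ι
  obtain ⟨y, hy⟩ := hS.rep (F.image fun a => List.ofFn (a ∘ e.symm)) hε
  refine ⟨fun i => (S [1])⁻¹ • y (e i), fun a ha => ?_⟩
  have h := hy _ (Finset.mem_image_of_mem _ ha)
  have hsum : pSum p (List.ofFn (a ∘ e.symm)) = ∑ i, |a i| ^ p := by
    rw [pSum, List.map_ofFn, List.sum_ofFn, ← e.sum_comp]
    simp
  have hcomb : comb y (List.ofFn (a ∘ e.symm)) = ∑ i, a i • y (e i) := by
    rw [comb_ofFn, ← e.sum_comp]
    simp
  rw [hSp, hsum, hcomb] at h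
  have h1 : ∑ i, a i • (S [1])⁻¹ • y (e i) = (S [1])⁻¹ • ∑ i, a i • y (e i) := by
    rw [Finset.smul_sum]
    exact Finset.sum_congr rfl fun i _ => smul_comm _ _ _
  have h0 : 0 < S [1] := by linarith
  rw [h1, norm_smul, Real.norm_of_nonneg (by positivity)]
  have h2 : (S [1])⁻¹ * ‖∑ i, a i • y (e i)‖ - (∑ i, |a i| ^ p) ^ (1 / p) =
      (S [1])⁻¹ * (‖∑ i, a i • y (e i)‖ - (∑ i, |a i| ^ p) ^ (1 / p) * S [1]) := by
    field_simp
  rw [h2, abs_mul, abs_of_nonneg (by positivity : 0 ≤ (S [1])⁻¹)]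
  exact (mul_le_of_le_one_left (abs_nonneg _) (inv_le_one_of_one_le₀ hS1)).trans_lt h

end Krivine

/-- Krivine's theorem for spaces uniformly containing `ℓ_p^m`, uniformly on bounded sets. -/
theorem exists_abs_norm_rpow_sub_le {p : ℝ} [Fact (1 ≤ ENNReal.ofReal p)] (hp : 0 < p)
    {X : Type*} [NormedAddCommGroup X] [NormedSpace ℝ X] (hX : UnifContainsLp (ENNReal.ofReal p) X)
    (ι : Type*) [Fintype ι] (R : ℝ) {ε : ℝ} (hε : 0 < ε) :
    ∃ y : ι → X, ∀ a : ι → ℝ, ‖a‖ ≤ R → |‖∑ i, a i • y i‖ ^ p - ∑ i, |a i| ^ p| ≤ ε := by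
  classical
  let φ : (ι → ℝ) → ℝ := fun a => (∑ i, |a i| ^ p) ^ (1 / p)
  have hφ0 : ∀ a : ι → ℝ, 0 ≤ ∑ i, |a i| ^ p := fun a => Finset.sum_nonneg fun _ _ => by positivity
  have hφp : ∀ a, φ a ^ p = ∑ i, |a i| ^ p := fun a => by
    rw [← Real.rpow_mul (hφ0 a), one_div_mul_cancel hp.ne', Real.rpow_one]
  have hφc : Continuous φ :=
    (continuous_finsetSum _ fun i _ => (continuous_apply i).abs.rpow_const fun _ =>
      Or.inr hp.le).rpow_const fun _ => Or.inr (by positivity)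
  have hK : IsCompact (Metric.closedBall (0 : ι → ℝ) R) := isCompact_closedBall 0 R
  obtain ⟨B, hB⟩ := hK.exists_bound_of_continuousOn hφc.continuousOn
  obtain ⟨δ, hδ, hpow⟩ := Metric.uniformContinuousOn_iff.1
    ((isCompact_Icc (a := 0) (b := B + 1)).uniformContinuousOn_of_continuous
      (f := fun t : ℝ => t ^ p) (continuous_id.rpow_const fun _ => Or.inr hp.le).continuousOn) ε hε
  set θ := min δ 1 / 4 with hθ
  have hθ0 : 0 < θ := by positivity
  have hθ1 : 4 * θ ≤ δ ∧ 4 * θ ≤ 1 :=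
    ⟨by linarith [min_le_left δ 1], by linarith [min_le_right δ 1]⟩
  obtain ⟨η, hη, hφu⟩ := Metric.uniformContinuousOn_iff.1
    (hK.uniformContinuousOn_of_continuous hφc.continuousOn) θ hθ0
  set c : ℝ := (Fintype.card ι : ℝ)
  have hc : 0 ≤ c := Nat.cast_nonneg _
  set η' := min η (θ / (2 * c + 1))
  have hη'0 : 0 < η' := by positivity
  obtain ⟨F, hFK, hF, hcov⟩ := hK.finite_cover_balls hη'0
  obtain ⟨y, hy⟩ := exists_abs_norm_sub_lt hp hX
    (hF.toFinset ∪ Finset.univ.image fun i => Pi.single i 1) hθ0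
  have hyn : ∀ i, ‖y i‖ ≤ 2 := fun i => by
    have h := hy (Pi.single i 1) (by simp)
    have h1 : ∑ j, |(Pi.single i 1 : ι → ℝ) j| ^ p = 1 := by
      rw [Finset.sum_eq_single i (fun j _ hj => by simp [hj, Real.zero_rpow hp.ne']) (by simp)]
      simp
    have h2 : ∑ j, (Pi.single i 1 : ι → ℝ) j • y j = y i := by
      rw [Finset.sum_eq_single i (fun j _ hj => by simp [hj]) (by simp)]
      simp
    rw [h1, h2, Real.one_rpow] at h
    linarith [(abs_lt.1 h).2]
  refine ⟨y, fun a ha => ?_⟩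
  have haK : a ∈ Metric.closedBall (0 : ι → ℝ) R := by simpa using ha
  obtain ⟨b, hbF, hab⟩ := Set.mem_iUnion₂.1 (hcov haK)
  have hab' : dist a b < η' := hab
  have h1 : |φ a - φ b| < θ := hφu a haK b (hFK hbF) (hab'.trans_le (min_le_left _ _))
  have h2 : |‖∑ i, b i • y i‖ - φ b| < θ := hy b (by simp [hbF])
  have h3 : |‖∑ i, a i • y i‖ - ‖∑ i, b i • y i‖| ≤ θ := by
    calc |‖∑ i, a i • y i‖ - ‖∑ i, b i • y i‖|
        ≤ ‖∑ i, a i • y i - ∑ i, b i • y i‖ := abs_norm_sub_norm_le _ _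
      _ = ‖∑ i, (a - b) i • y i‖ := by simp [← Finset.sum_sub_distrib, sub_smul]
      _ ≤ ∑ i : ι, η' * 2 := norm_sum_le_of_le _ fun i _ => by
          rw [norm_smul]
          have := (norm_le_pi_norm (a - b) i).trans (dist_eq_norm a b ▸ hab'.le)
          exact mul_le_mul this (hyn i) (norm_nonneg _) hη'0.le
      _ = 2 * c * η' := by simp [c]; ring
      _ ≤ (2 * c + 1) * (θ / (2 * c + 1)) := by
          gcongr
          · linarith
          · exact min_le_right _ _
      _ = θ := by field_simp
  have h4 : |‖∑ i, a i • y i‖ - φ a| < 4 * θ := by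
    have := abs_sub_le ‖∑ i, a i • y i‖ ‖∑ i, b i • y i‖ (φ a)
    have := abs_sub_le ‖∑ i, b i • y i‖ (φ b) (φ a)
    rw [abs_sub_comm (φ b)] at this
    linarith
  have hφa : φ a ≤ B := (le_abs_self _).trans (hB a haK)
  have h5 := hpow ‖∑ i, a i • y i‖ ⟨norm_nonneg _, by linarith [(abs_lt.1 h4).2]⟩ (φ a)
    ⟨Real.rpow_nonneg (hφ0 a) _, by linarith⟩ (h4.trans_le hθ1.1)
  rw [← hφp]
  exact h5.le

/-! ### Perturbations of the distance map -/

lemma ConvexOn.sub_sub_le_of_approx {E : Type*} [NormedAddCommGroup E] [NormedSpace ℝ E]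
    {h G : E → ℝ} {L : E →L[ℝ] ℝ} {z₀ : E} {r c ε κ : ℝ} (hconv : ConvexOn ℝ Set.univ h)
    (hr : 0 < r)
    (hG : ∀ x ∈ Metric.closedBall z₀ r, ∀ y ∈ Metric.closedBall z₀ r,
      |G x - G y - L (x - y)| ≤ c * ‖x - y‖)
    (hh : ∀ z ∈ Metric.closedBall z₀ r, |h z - G z - κ| ≤ ε) {w z : E}
    (hw : w ∈ Metric.closedBall z₀ (r / 2)) (hz : z ∈ Metric.closedBall z₀ (r / 2)) :
    h w - h z - L (w - z) ≤ (c + 4 * ε / r) * ‖w - z‖ := by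
  rcases eq_or_ne w z with rfl | hne
  · simp
  set d := ‖w - z‖ with hd
  have hd0 : 0 < d := norm_pos_iff.2 (sub_ne_zero.2 hne)
  set u := w + (r / 2 / d) • (w - z) with hu
  have huw : u - w = (r / 2 / d) • (w - z) := add_sub_cancel_left _ _
  have hnorm : ‖u - w‖ = r / 2 := by
    rw [huw, norm_smul, Real.norm_of_nonneg (by positivity), ← hd]
    field_simp
  have hwr : w ∈ Metric.closedBall z₀ r := Metric.closedBall_subset_closedBall (by linarith) hw
  have hur : u ∈ Metric.closedBall z₀ r := by
    rw [Metric.mem_closedBall] at hw ⊢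
    have := dist_triangle u w z₀
    rw [dist_eq_norm u w, hnorm] at this
    linarith
  have hcomb : (r / 2 / (d + r / 2)) • z + (d / (d + r / 2)) • u = w := by
    rw [hu]
    match_scalars <;> field_simp
    ring
  have h1 := hconv.2 (Set.mem_univ z) (Set.mem_univ u)
    (by positivity : 0 ≤ r / 2 / (d + r / 2)) (by positivity : 0 ≤ d / (d + r / 2))
    (by field_simp; ring)
  rw [hcomb, smul_eq_mul, smul_eq_mul, div_mul_eq_mul_div (r / 2), div_mul_eq_mul_div d, ← add_div,
    le_div_iff₀ (by positivity)] at h1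
  have h2 := (abs_le.1 (hG u hur w hwr)).2
  rw [hnorm, huw, map_smul, smul_eq_mul] at h2
  have h3 := (abs_le.1 (hh u hur)).2
  have h4 := (abs_le.1 (hh w hwr)).1
  have h5 : h u - h w ≤ r / 2 / d * L (w - z) + c * (r / 2) + 2 * ε := by linarith
  have h6 : r / 2 * (h w - h z) ≤ d * (r / 2 / d * L (w - z) + c * (r / 2) + 2 * ε) := by
    have := mul_le_mul_of_nonneg_left h5 hd0.le
    linarith
  have h7 : d * (r / 2 / d * L (w - z) + c * (r / 2) + 2 * ε) =
      r / 2 * (L (w - z) + (c + 4 * ε / r) * d) := by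
    field_simp
    ring
  rw [h7] at h6
  linarith [le_of_mul_le_mul_left h6 (by positivity)]

/-- A small perturbation, up to constants, of a map with surjective strict derivative attains the
expected value if its coordinates are convex. -/
lemma HasStrictFDerivAt.exists_perturbation_eq {E ι : Type*} [NormedAddCommGroup E]
    [NormedSpace ℝ E] [CompleteSpace E] [Fintype ι] {F : E → ι → ℝ} {F' : E →L[ℝ] ι → ℝ} {z₀ : E}
    (hF : HasStrictFDerivAt F F' z₀) (hsurj : F'.range = ⊤) :
    ∃ r > 0, ∃ ε > 0, ∀ (H : E → ι → ℝ) (κ : ι → ℝ),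
      (∀ q, ConvexOn ℝ Set.univ fun z => H z q) →
      (∀ z ∈ Metric.closedBall z₀ r, ∀ q, |H z q - F z q - κ q| ≤ ε) →
      ∃ z, H z = F z₀ + κ := by
  let g := F'.nonlinearRightInverseOfSurjective hsurj
  have hg : 0 < g.nnnorm := F'.nonlinearRightInverseOfSurjective_nnnorm_pos hsurj
  set c : NNReal := g.nnnorm⁻¹ / 4 with hc
  have hc0 : 0 < c := by positivity
  obtain ⟨s, hs, happrox⟩ := hF.approximates_deriv_on_nhds (Or.inr hc0)
  obtain ⟨r, hr, hrs⟩ := Metric.nhds_basis_closedBall.mem_iff.1 hs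
  have hcr : (0 : ℝ) < c := hc0
  refine ⟨r, hr, c * r / 4, by positivity, fun H κ hconv hH => ?_⟩
  have hle : ∀ q, ∀ w ∈ Metric.closedBall z₀ (r / 2), ∀ z ∈ Metric.closedBall z₀ (r / 2),
      H w q - H z q - F' (w - z) q ≤ (2 * c : ℝ) * ‖w - z‖ := fun q w hw z hz => by
    have := (hconv q).sub_sub_le_of_approx (G := fun z => F z q) (c := c) (κ := κ q)
      (L := (ContinuousLinearMap.proj q).comp F') hr (fun x hx y hy =>
        (norm_le_pi_norm _ q).trans (happrox _ (hrs hx) _ (hrs hy)))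
      (fun z hz => hH z hz q) hw hz
    refine this.trans_eq ?_
    field_simp
    ring
  have hHa : ApproximatesLinearOn H F' (Metric.closedBall z₀ (r / 2)) (2 * c) :=
    fun w hw z hz => by
      refine (pi_norm_le_iff_of_nonneg (by positivity)).2 fun q => ?_
      have h1 := hle q w hw z hz
      have h2 := hle q z hz w hw
      rw [← neg_sub w z, map_neg, norm_neg] at h2
      simp only [Pi.neg_apply] at h2
      simp only [Pi.sub_apply, Real.norm_eq_abs, NNReal.coe_mul, NNReal.coe_ofNat]
      exact abs_le.2 ⟨by linarith, h1⟩
  have hmem : F z₀ + κ ∈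
      Metric.closedBall (H z₀) (((g.nnnorm : ℝ)⁻¹ - (2 * c : NNReal)) * (r / 2)) := by
    have h4 : ((g.nnnorm : ℝ)⁻¹ - (2 * c : NNReal)) * (r / 2) = c * r := by
      simp only [hc]
      push_cast
      ring
    rw [h4, Metric.mem_closedBall, dist_comm, dist_eq_norm]
    refine (pi_norm_le_iff_of_nonneg (by positivity)).2 fun q => ?_
    have := hH z₀ (Metric.mem_closedBall_self hr.le) q
    rw [Pi.sub_apply, Pi.add_apply, ← sub_sub]
    refine this.trans ?_
    nlinarith [mul_pos hcr hr]
  obtain ⟨z, -, hz⟩ := hHa.surjOn_closedBall_of_nonlinearRightInverse g (by positivity) subset_rfl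
    hmem
  exact ⟨z, hz⟩

lemma card_pairIdx (n : ℕ) : Fintype.card (PairIdx n) = n * (n - 1) / 2 := by
  let e : PairIdx n ≃ Σ j : Fin n, Fin j :=
    { toFun q := ⟨q.1.2, ⟨q.1.1, q.2⟩⟩
      invFun s := ⟨(⟨s.2, s.2.2.trans s.1.2⟩, s.1), s.2.2⟩
      left_inv _ := rfl
      right_inv _ := rfl }
  rw [Fintype.card_congr e, Fintype.card_sigma]
  simp only [Fintype.card_fin]
  rw [Fin.sum_univ_eq_sum_range (fun i => i), Finset.sum_range_id]

lemma contDiff_Fmap {p : ℝ} (hp : 1 < p) (n : ℕ) : ContDiff ℝ 1 (Fmap p n) := by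
  refine contDiff_pi.2 fun q => ContDiff.sum fun k _ => ?_
  exact (contDiff_norm_rpow (E := ℝ) hp).comp
    ((contDiff_apply_apply ℝ ℝ q.val.1 k).sub (contDiff_apply_apply ℝ ℝ q.val.2 k))

lemma range_fderiv_eq_top {p : ℝ} {n : ℕ} {z : Fin n → Fin n → ℝ} (hz : z ∈ Gset p n) :
    (fderiv ℝ (Fmap p n) z).range = ⊤ := by
  refine Submodule.eq_top_of_finrank_eq ?_
  rw [Module.finrank_fintype_fun_eq_card, card_pairIdx]
  exact Module.finrank_eq_of_rank_eq hz

lemma convexOn_norm_rpow_comp {E X : Type*} [AddCommGroup E] [Module ℝ E] [NormedAddCommGroup X]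
    [NormedSpace ℝ X] {p : ℝ} (hp : 1 ≤ p) (A : E →ᵃ[ℝ] X) :
    ConvexOn ℝ Set.univ fun z => ‖A z‖ ^ p := by
  have h : ConvexOn ℝ Set.univ fun z => ‖A z‖ := convexOn_univ_norm.comp_affineMap A
  refine ⟨convex_univ, fun x hx y hy a b ha hb hab => ?_⟩
  refine (Real.rpow_le_rpow (norm_nonneg _) (h.2 hx hy ha hb hab) (by linarith)).trans ?_
  exact (convexOn_rpow hp).2 (norm_nonneg (A x)) (norm_nonneg (A y)) ha hb hab

lemma lp_hasSum_compl {p : ℝ} (hp : 0 < p) [Fact (1 ≤ ENNReal.ofReal p)]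
    (d : lp (fun _ : ℕ => ℝ) (ENNReal.ofReal p)) {n : ℕ} {m : Fin n → ℕ}
    (hm : Function.Injective m) :
    HasSum (fun k => if k ∈ Set.range m then 0 else |d k| ^ p) (‖d‖ ^ p - ∑ j, |d (m j)| ^ p) := by
  classical
  have hp' : (ENNReal.ofReal p).toReal = p := ENNReal.toReal_ofReal hp.le
  have h1 := lp.hasSum_norm (by rw [hp']; exact hp) d
  rw [hp'] at h1
  have h2 : HasSum (fun k => if k ∈ Set.range m then |d k| ^ p else 0) (∑ j, |d (m j)| ^ p) := by
    have h3 := hasSum_sum_of_ne_finset_zero (L := .unconditional ℕ) (s := Finset.univ.image m)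
      (f := fun k => if k ∈ Set.range m then |d k| ^ p else 0)
      (fun k hk => if_neg (by simpa using hk))
    rwa [Finset.sum_image hm.injOn, Finset.sum_congr rfl fun j _ => if_pos (Set.mem_range_self j)]
      at h3
  refine (h1.sub h2).congr_fun fun k => ?_
  rw [Real.norm_eq_abs]
  split_ifs <;> simp

/-- The powers of the distances between `∑ k, z i k • y k + b i` are convex functions of `z`. -/
lemma convexOn_norm_sub_rpow {X : Type*} [NormedAddCommGroup X] [NormedSpace ℝ X] {p : ℝ}
    (hp : 1 ≤ p) {n : ℕ} {κ : Type*} [Fintype κ] (g : Fin n → κ → ℝ) (y : Fin n ⊕ κ → X)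
    (i j : Fin n) :
    ConvexOn ℝ Set.univ fun z : Fin n → Fin n → ℝ =>
      ‖∑ s, (Sum.elim (z i) (g i) s - Sum.elim (z j) (g j) s) • y s‖ ^ p := by
  let A : (Fin n → Fin n → ℝ) →ₗ[ℝ] X :=
    { toFun z := ∑ k, (z i k - z j k) • y (.inl k)
      map_add' z w := by
        rw [← Finset.sum_add_distrib]
        refine Finset.sum_congr rfl fun k _ => ?_
        rw [← add_smul, Pi.add_apply, Pi.add_apply, Pi.add_apply, Pi.add_apply]
        congr 1
        ring
      map_smul' c z := by
        simp [Finset.smul_sum, smul_smul, mul_sub] }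
  convert! convexOn_norm_rpow_comp hp
    (A.toAffineMap + AffineMap.const ℝ _ (∑ k, (g i k - g j k) • y (.inr k))) using 4 with z
  rw [Fintype.sum_sum_type]
  rfl

end

/-- If an `n`-tuple `x` of points of `ℓ_p` has Property K and `X` is a
Banach space uniformly containing the spaces `ℓ_p^m`, then `{x₁,…,xₙ}` with the metric
inherited from `ℓ_p` embeds isometrically into `X`. -/
theorem stmt8 (p : ℝ) (hp : 1 < p) [Fact (1 ≤ ENNReal.ofReal p)] (n : ℕ)
    (x : Fin n → lp (fun _ : ℕ => ℝ) (ENNReal.ofReal p))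
    (hx : PropertyKSeq p n (fun i k => x i k))
    (X : Type*) [NormedAddCommGroup X] [NormedSpace ℝ X] [CompleteSpace X]
    (hX : UnifContainsLp (ENNReal.ofReal p) X) :
    ∃ f : Fin n → X, ∀ i j, dist (f i) (f j) = dist (x i) (x j) := by
  classical
  have hp0 : 0 < p := by linarith
  obtain ⟨m, hm, hG⟩ := hx
  set z₀ : Fin n → Fin n → ℝ := fun i j => x i (m j)
  obtain ⟨r, hr, ε, hε, hpert⟩ :=
    ((contDiff_Fmap hp n).contDiffAt.hasStrictFDerivAt one_ne_zero).exists_perturbation_eq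
      (range_fderiv_eq_top hG)
  let g : Fin n → ℕ → ℝ := fun i k => if k ∈ Set.range m then 0 else x i k
  let κ : PairIdx n → ℝ := fun q => ‖x q.val.1 - x q.val.2‖ ^ p - Fmap p n z₀ q
  have hκ : ∀ q : PairIdx n, HasSum (fun k => |g q.val.1 k - g q.val.2 k| ^ p) (κ q) := fun q => by
    refine (lp_hasSum_compl hp0 (x q.val.1 - x q.val.2) hm.injective).congr_fun fun k => ?_
    by_cases hk : k ∈ Set.range m
    · simp only [g, hk, if_true, sub_zero, abs_zero, Real.zero_rpow hp0.ne']
    · simp only [g, hk, if_false]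
      rfl
  obtain ⟨N, hN⟩ : ∃ N : ℕ, ∀ q : PairIdx n,
      |∑ k ∈ Finset.range N, |g q.val.1 k - g q.val.2 k| ^ p - κ q| < ε / 2 :=
    (Filter.eventually_all.2 fun q => (hκ q).tendsto_sum_nat.eventually
      (Metric.ball_mem_nhds _ (half_pos hε))).exists
  let V : (Fin n → Fin n → ℝ) → Fin n → Fin n ⊕ Fin N → ℝ := fun z i =>
    Sum.elim (z i) fun k => g i k
  have hV : Continuous fun z (q : PairIdx n) => V z q.val.1 - V z q.val.2 := by
    have hVi : ∀ i, Continuous fun z => V z i := fun i => continuous_pi fun s => by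
      cases s with
      | inl k => exact continuous_apply_apply i k
      | inr k => exact continuous_const
    exact continuous_pi fun q => (hVi _).sub (hVi _)
  obtain ⟨R, hR⟩ := (isCompact_closedBall z₀ r).exists_bound_of_continuousOn hV.continuousOn
  obtain ⟨y, hy⟩ := exists_abs_norm_rpow_sub_le hp0 hX (Fin n ⊕ Fin N) R (half_pos hε)
  obtain ⟨z, hz⟩ := hpert
    (fun z q => ‖∑ s, (V z q.val.1 s - V z q.val.2 s) • y s‖ ^ p) κ
    (fun q => convexOn_norm_sub_rpow hp.le (fun i (k : Fin N) => g i k) y q.val.1 q.val.2)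
    fun z hz q => by
      have h1 := hy _ ((norm_le_pi_norm _ q).trans (hR z hz))
      have h2 := hN q
      have h3 : ∑ s, |(V z q.val.1 - V z q.val.2) s| ^ p = Fmap p n z q +
          ∑ k : Fin N, |g q.val.1 k - g q.val.2 k| ^ p := Fintype.sum_sum_type _
      rw [h3] at h1
      rw [Finset.sum_range] at h2
      simp only [Pi.sub_apply] at h1
      rw [abs_le] at h1 ⊢
      rw [abs_lt] at h2
      constructor <;> linarith
  let f : Fin n → X := fun i => ∑ s, V z i s • y s
  have hlt : ∀ i j, i < j → dist (f i) (f j) = dist (x i) (x j) := fun i j hij => by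
    have h := congr_fun hz ⟨(i, j), hij⟩
    simp only [κ, Pi.add_apply, add_sub_cancel, sub_smul, Finset.sum_sub_distrib] at h
    rw [dist_eq_norm, dist_eq_norm]
    exact (Real.rpow_left_inj (norm_nonneg _) (norm_nonneg _) hp0.ne').1 h
  refine ⟨f, fun i j => ?_⟩
  rcases lt_trichotomy i j with h | rfl | h
  · exact hlt i j h
  · simp
  · rw [dist_comm, hlt j i h, dist_comm]
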